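/- Normalization identity for the type-D R-matrix: work in the field ℚ(q, z) of rational functions in two variables q and z, and fix an integer d ≥ 0. With a_{j,ℓ} as defined below, define for 0 ≤ j ≤ d+1 with j ≡ d+1 (mod 2): if d is odd (so j is even), ρ_j(z) := ∏_{i=1}^{j/2} (q^{2i−1} − q^{−2i+1} z) · ∏_{i=j/2+1}^{(d+1)/2} (q^{2i−1} z − q^{−2i+1}); if d is even (so j is odd), ρ_j(z) := ∏_{i=1}^{(j−1)/2} (q^{2i} − q^{−2i} z) · ∏_{i=(j+1)/2}^{d/2} (q^{2i} z − q^{−2i}). Define c(z) := ∏_{i=1}^{(d+1)/2} (q^{2i−2} z − q^{−2i+2}) if d is odd, and c(z) := ∏_{i=1}^{d/2} (q^{2i−1} z − q^{−2i+1}) if d is even. Then Σ_{j=0, j ≡ d+1 (mod 2)}^{d+1} ρ_j(z) · a_{j,d+1} = c(z). -/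

import Mathlib

noncomputable section

/-- The field `ℚ(q, z)` of rational functions in two variables, realized as
`ℚ(q)(z)`. -/
abbrev QZ : Type := RatFunc (RatFunc ℚ)

/-- The variable `q`. -/
def q : QZ := RatFunc.C RatFunc.X

/-- The variable `z`. -/
def z : QZ := RatFunc.X

/-- `[m] := q^m − q^{−m}`. -/
def br (m : ℤ) : QZ := q ^ m - q ^ (-m)

/-- `g(j) = [2j]/[j]` for `j > 0`, `g(0) = 1`. -/
def g (j : ℤ) : QZ := if j = 0 then 1 else br (2 * j) / br j

/-- The coefficients `a_{j,ℓ}`: zero unless `0 ≤ j ≤ ℓ` and `j ≡ ℓ (mod 2)`, in which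
case `a_{j,ℓ} = (−1)^{⌊j/2⌋} (∏_{i=1}^{⌈ℓ/2⌉} [2i−1]) /
(∏_{i=1}^{(ℓ−j)/2} [2i] · ∏_{i=⌈(ℓ+1)/2⌉}^{(ℓ+j)/2} [2i]) · g(j)`. -/
def a (j : ℤ) (l : ℕ) : QZ :=
  if 0 ≤ j ∧ j ≤ (l : ℤ) ∧ j % 2 = (l : ℤ) % 2 then
    (-1 : QZ) ^ (j.toNat / 2) *
      (∏ i ∈ Finset.Icc 1 ((l + 1) / 2), br (2 * (i : ℤ) - 1)) /
      ((∏ i ∈ Finset.Icc 1 ((l - j.toNat) / 2), br (2 * (i : ℤ))) *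
        (∏ i ∈ Finset.Icc ((l + 2) / 2) ((l + j.toNat) / 2), br (2 * (i : ℤ)))) *
      g j
  else 0

/-- The functions `ρ_j(z)` (for `0 ≤ j ≤ d+1` with `j ≡ d+1 (mod 2)`):
if `d` is odd, `ρ_j(z) = ∏_{i=1}^{j/2} (q^{2i−1} − q^{−2i+1} z) ·
∏_{i=j/2+1}^{(d+1)/2} (q^{2i−1} z − q^{−2i+1})`; if `d` is even,
`ρ_j(z) = ∏_{i=1}^{(j−1)/2} (q^{2i} − q^{−2i} z) · ∏_{i=(j+1)/2}^{d/2} (q^{2i} z − q^{−2i})`. -/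
def rho (d j : ℕ) : QZ :=
  if d % 2 = 1 then
    (∏ i ∈ Finset.Icc 1 (j / 2), (q ^ (2 * (i : ℤ) - 1) - q ^ (1 - 2 * (i : ℤ)) * z)) *
      (∏ i ∈ Finset.Icc (j / 2 + 1) ((d + 1) / 2),
        (q ^ (2 * (i : ℤ) - 1) * z - q ^ (1 - 2 * (i : ℤ))))
  else
    (∏ i ∈ Finset.Icc 1 ((j - 1) / 2), (q ^ (2 * (i : ℤ)) - q ^ (-(2 * (i : ℤ))) * z)) *
      (∏ i ∈ Finset.Icc ((j + 1) / 2) (d / 2),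
        (q ^ (2 * (i : ℤ)) * z - q ^ (-(2 * (i : ℤ)))))

/-- The normalization factor `c(z)`: `∏_{i=1}^{(d+1)/2} (q^{2i−2} z − q^{−2i+2})` for
`d` odd, `∏_{i=1}^{d/2} (q^{2i−1} z − q^{−2i+1})` for `d` even. -/
def cz (d : ℕ) : QZ :=
  if d % 2 = 1 then
    ∏ i ∈ Finset.Icc 1 ((d + 1) / 2), (q ^ (2 * (i : ℤ) - 2) * z - q ^ (2 - 2 * (i : ℤ)))
  else
    ∏ i ∈ Finset.Icc 1 (d / 2), (q ^ (2 * (i : ℤ) - 1) * z - q ^ (1 - 2 * (i : ℤ)))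

section FieldIdentities

variable {K : Type*} [Field K]

lemma telescoping_identity (x u v y : K) (hx : x ≠ 0) (hu : u ≠ 0) (hv : v ≠ 0) :
    (u * x - (u * x)⁻¹) * (v * x ^ 2 / u - u / (v * x ^ 2)) * (u * x - (u * x)⁻¹ * y) +
      (u / x - x / u) * (v * x ^ 2 * u - (v * x ^ 2 * u)⁻¹) * (u / x * y - x / u) =
    (u + u⁻¹) * ((v * x - (v * x)⁻¹) * (v * x ^ 2 - (v * x ^ 2)⁻¹) * (v * x * y - (v * x)⁻¹) -
      (v * y - v⁻¹) * (v * x ^ 2 / u - u / (v * x ^ 2)) *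
        (v * x ^ 2 * u - (v * x ^ 2 * u)⁻¹)) := by
  field_simp
  ring

lemma telescoping_identity_zero (x v y : K) (hx : x ≠ 0) (hv : v ≠ 0) :
    (x - x⁻¹) * (x - x⁻¹ * y) =
      (v * x - (v * x)⁻¹) * (v * x * y - (v * x)⁻¹) -
        (v * y - v⁻¹) * (v * x ^ 2 - (v * x ^ 2)⁻¹) := by
  field_simp
  ring

end FieldIdentities

lemma q_ne_zero : q ≠ 0 := by
  simp [q, RatFunc.X_ne_zero]

lemma br_ne_zero {m : ℕ} (hm : 0 < m) : br m ≠ 0 := by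
  intro h
  rw [br, sub_eq_zero, zpow_neg, ← mul_eq_one_iff_eq_inv₀ (zpow_ne_zero _ q_ne_zero), zpow_natCast,
    ← pow_add, q, ← map_pow, ← map_one (RatFunc.C (K := RatFunc ℚ))] at h
  have h' := RatFunc.C_injective h
  rw [← RatFunc.algebraMap_X, ← map_pow, ← map_one (algebraMap (Polynomial ℚ) (RatFunc ℚ))] at h'
  have h'' := congrArg Polynomial.natDegree (RatFunc.algebraMap_injective ℚ h')
  simp at h''
  omega

lemma g_eq {m : ℕ} (hm : 0 < m) : g m = q ^ (m : ℤ) + (q ^ (m : ℤ))⁻¹ := by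
  have h := br_ne_zero hm
  rw [g, if_neg (by omega), div_eq_iff h, br, br, two_mul, neg_add, zpow_add₀ q_ne_zero,
    zpow_add₀ q_ne_zero, zpow_neg]
  ring

/-- The product `[2][4]⋯[2m]`. -/
def evenBr (m : ℕ) : QZ := ∏ i ∈ Finset.range m, br ((2 * i + 2 : ℕ) : ℤ)

/-- The product `[1][3]⋯[2m−1]`. -/
def oddBr (m : ℕ) : QZ := ∏ i ∈ Finset.range m, br ((2 * i + 1 : ℕ) : ℤ)

/-- The linear factor `q^m z − q^{−m}`. -/
def fwd (m : ℤ) : QZ := q ^ m * z - q ^ (-m)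

/-- The linear factor `q^m − q^{−m} z`. -/
def bwd (m : ℤ) : QZ := q ^ m - q ^ (-m) * z

/-- The function `ρ_j` for `ℓ = 2n + ε` and `j = 2k + ε`. -/
def rhoProd (ε n k : ℕ) : QZ :=
  (∏ i ∈ Finset.range k, bwd ((2 * i + 1 + ε : ℕ) : ℤ)) *
    ∏ i ∈ Finset.Ico k n, fwd ((2 * i + 1 + ε : ℕ) : ℤ)

/-- The summand for `ℓ = 2n + ε` and `j = 2k + ε`, without the numerator that does not
depend on `k`. -/
def summand (ε n k : ℕ) : QZ :=
  (-1) ^ k * g ((2 * k + ε : ℕ) : ℤ) * rhoProd ε n k / (evenBr (n - k) * evenBr (n + k + ε))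

/-- The partial sums of the telescoping sum in `telescoping_sum`. -/
def antidiff (ε n k : ℕ) : QZ :=
  (-1) ^ k * br ((2 * k + 1 + ε : ℕ) : ℤ) * (bwd ((2 * k + 1 + ε : ℕ) : ℤ) * rhoProd ε n k) /
    (evenBr (n - k) * evenBr (n + k + ε + 1))

lemma evenBr_ne_zero (m : ℕ) : evenBr m ≠ 0 :=
  Finset.prod_ne_zero_iff.2 fun _ _ => br_ne_zero (by omega)

lemma evenBr_succ (m : ℕ) : evenBr (m + 1) = evenBr m * br ((2 * m + 2 : ℕ) : ℤ) :=
  Finset.prod_range_succ _ _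

lemma oddBr_succ (m : ℕ) : oddBr (m + 1) = oddBr m * br ((2 * m + 1 : ℕ) : ℤ) :=
  Finset.prod_range_succ _ _

lemma rhoProd_succ_left (ε : ℕ) {n k : ℕ} (h : k ≤ n) :
    rhoProd ε (n + 1) k = rhoProd ε n k * fwd ((2 * n + 1 + ε : ℕ) : ℤ) := by
  rw [rhoProd, rhoProd, Finset.prod_Ico_succ_top h, mul_assoc]

lemma rhoProd_succ_right (ε : ℕ) {n k : ℕ} (h : k < n) :
    bwd ((2 * k + 1 + ε : ℕ) : ℤ) * rhoProd ε n k =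
      fwd ((2 * k + 1 + ε : ℕ) : ℤ) * rhoProd ε n (k + 1) := by
  rw [rhoProd, rhoProd, Finset.prod_eq_prod_Ico_succ_bot h, Finset.prod_range_succ]
  ring

/-- For `ℓ = 2n + ε`, the ratio of the summands for `ℓ + 2` and `ℓ` at the same index. -/
lemma summand_succ (ε : ℕ) {n k : ℕ} (h : k ≤ n) :
    summand ε (n + 1) k = summand ε n k * fwd ((2 * n + 1 + ε : ℕ) : ℤ) /
      (br ((2 * (n - k) + 2 : ℕ) : ℤ) * br ((2 * (n + k + ε) + 2 : ℕ) : ℤ)) := by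
  rw [summand, summand, rhoProd_succ_left ε h, show n + 1 - k = n - k + 1 by omega,
    show n + 1 + k + ε = n + k + ε + 1 by omega, evenBr_succ, evenBr_succ]
  have := evenBr_ne_zero (n - k)
  have := evenBr_ne_zero (n + k + ε)
  have := br_ne_zero (show 0 < 2 * (n - k) + 2 by omega)
  have := br_ne_zero (show 0 < 2 * (n + k + ε) + 2 by omega)
  field_simp

lemma summand_recurrence_of_pos {ε n k : ℕ} (hk : k ≤ n) (hj : 0 < 2 * k + ε) :
    br ((2 * n + 1 + ε : ℕ) : ℤ) * br ((2 * n + 2 + ε : ℕ) : ℤ) * summand ε (n + 1) k -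
        fwd ((2 * n + ε : ℕ) : ℤ) * summand ε n k =
      antidiff ε n k +
        (-1) ^ k * br (2 * k + ε - 1) * (fwd (2 * k + ε - 1) * rhoProd ε n k) /
          (evenBr (n - k + 1) * evenBr (n + k + ε)) := by
  have h1 := evenBr_ne_zero (n - k)
  have h2 := evenBr_ne_zero (n + k + ε)
  have h3 := br_ne_zero (show 0 < 2 * (n - k) + 2 by omega)
  have h4 := br_ne_zero (show 0 < 2 * (n + k + ε) + 2 by omega)
  have hq := q_ne_zero
  have key := telescoping_identity q (q ^ ((2 * k + ε : ℕ) : ℤ)) (q ^ ((2 * n + ε : ℕ) : ℤ)) z hq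
    (zpow_ne_zero _ hq) (zpow_ne_zero _ hq)
  have e1 : br ((2 * n + 1 + ε : ℕ) : ℤ) =
      q ^ ((2 * n + ε : ℕ) : ℤ) * q - (q ^ ((2 * n + ε : ℕ) : ℤ) * q)⁻¹ := by
    rw [br, zpow_neg, ← zpow_add_one₀ hq]; push_cast; ring_nf
  have e2 : br ((2 * n + 2 + ε : ℕ) : ℤ) =
      q ^ ((2 * n + ε : ℕ) : ℤ) * q ^ 2 - (q ^ ((2 * n + ε : ℕ) : ℤ) * q ^ 2)⁻¹ := by
    rw [br, zpow_neg, ← zpow_natCast q 2, ← zpow_add₀ hq]; push_cast; ring_nf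
  have e3 : br ((2 * (n - k) + 2 : ℕ) : ℤ) =
      q ^ ((2 * n + ε : ℕ) : ℤ) * q ^ 2 / q ^ ((2 * k + ε : ℕ) : ℤ) -
        q ^ ((2 * k + ε : ℕ) : ℤ) / (q ^ ((2 * n + ε : ℕ) : ℤ) * q ^ 2) := by
    rw [br, ← zpow_natCast q 2, ← zpow_add₀ hq, ← zpow_sub₀ hq, ← zpow_sub₀ hq]
    push_cast [hk]; ring_nf
  have e4 : br ((2 * (n + k + ε) + 2 : ℕ) : ℤ) =
      q ^ ((2 * n + ε : ℕ) : ℤ) * q ^ 2 * q ^ ((2 * k + ε : ℕ) : ℤ) -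
        (q ^ ((2 * n + ε : ℕ) : ℤ) * q ^ 2 * q ^ ((2 * k + ε : ℕ) : ℤ))⁻¹ := by
    rw [br, zpow_neg, ← zpow_natCast q 2, ← zpow_add₀ hq, ← zpow_add₀ hq]; push_cast; ring_nf
  have e5 : br ((2 * k + 1 + ε : ℕ) : ℤ) =
      q ^ ((2 * k + ε : ℕ) : ℤ) * q - (q ^ ((2 * k + ε : ℕ) : ℤ) * q)⁻¹ := by
    rw [br, zpow_neg, ← zpow_add_one₀ hq]; push_cast; ring_nf
  have e6 : br (2 * k + ε - 1) =
      q ^ ((2 * k + ε : ℕ) : ℤ) / q - q / q ^ ((2 * k + ε : ℕ) : ℤ) := by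
    rw [br, neg_sub, zpow_sub_one₀ hq, zpow_sub₀ hq 1, zpow_one, div_eq_mul_inv _ q]; push_cast; rfl
  have e7 : bwd ((2 * k + 1 + ε : ℕ) : ℤ) =
      q ^ ((2 * k + ε : ℕ) : ℤ) * q - (q ^ ((2 * k + ε : ℕ) : ℤ) * q)⁻¹ * z := by
    rw [bwd, zpow_neg, ← zpow_add_one₀ hq]; push_cast; ring_nf
  have e8 : fwd (2 * k + ε - 1) =
      q ^ ((2 * k + ε : ℕ) : ℤ) / q * z - q / q ^ ((2 * k + ε : ℕ) : ℤ) := by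
    rw [fwd, neg_sub, zpow_sub_one₀ hq, zpow_sub₀ hq 1, zpow_one, div_eq_mul_inv _ q]; push_cast; rfl
  have e9 : fwd ((2 * n + 1 + ε : ℕ) : ℤ) =
      q ^ ((2 * n + ε : ℕ) : ℤ) * q * z - (q ^ ((2 * n + ε : ℕ) : ℤ) * q)⁻¹ := by
    rw [fwd, zpow_neg, ← zpow_add_one₀ hq]; push_cast; ring_nf
  have e10 : fwd ((2 * n + ε : ℕ) : ℤ) =
      q ^ ((2 * n + ε : ℕ) : ℤ) * z - (q ^ ((2 * n + ε : ℕ) : ℤ))⁻¹ := by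
    rw [fwd, zpow_neg]
  rw [← e1, ← e2, ← e3, ← e4, ← e5, ← e6, ← e7, ← e8, ← e9, ← e10, ← g_eq hj] at key
  rw [summand_succ ε hk, summand, antidiff, evenBr_succ, evenBr_succ]
  field_simp
  linear_combination (-rhoProd ε n k) * key

lemma summand_zero_recurrence {ε : ℕ} (hε : ε ≤ 1) (n : ℕ) :
    br ((2 * n + 1 + ε : ℕ) : ℤ) * br ((2 * n + 2 + ε : ℕ) : ℤ) * summand ε (n + 1) 0 -
        fwd ((2 * n + ε : ℕ) : ℤ) * summand ε n 0 = antidiff ε n 0 := by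
  obtain rfl | rfl : ε = 0 ∨ ε = 1 := by omega
  · have hq := q_ne_zero
    have h1 := evenBr_ne_zero n
    have h2 := br_ne_zero (show 0 < 2 * n + 2 by omega)
    have key := telescoping_identity_zero q (q ^ ((2 * n : ℕ) : ℤ)) z hq (zpow_ne_zero _ hq)
    have e1 : br ((2 * n + 1 : ℕ) : ℤ) =
        q ^ ((2 * n : ℕ) : ℤ) * q - (q ^ ((2 * n : ℕ) : ℤ) * q)⁻¹ := by
      rw [br, zpow_neg, ← zpow_add_one₀ hq]; push_cast; ring_nf
    have e2 : br ((2 * n + 2 : ℕ) : ℤ) =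
        q ^ ((2 * n : ℕ) : ℤ) * q ^ 2 - (q ^ ((2 * n : ℕ) : ℤ) * q ^ 2)⁻¹ := by
      rw [br, zpow_neg, ← zpow_natCast q 2, ← zpow_add₀ hq]; push_cast; ring_nf
    have e3 : fwd ((2 * n + 1 : ℕ) : ℤ) =
        q ^ ((2 * n : ℕ) : ℤ) * q * z - (q ^ ((2 * n : ℕ) : ℤ) * q)⁻¹ := by
      rw [fwd, zpow_neg, ← zpow_add_one₀ hq]; push_cast; ring_nf
    have e4 : fwd ((2 * n : ℕ) : ℤ) =
        q ^ ((2 * n : ℕ) : ℤ) * z - (q ^ ((2 * n : ℕ) : ℤ))⁻¹ := by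
      rw [fwd, zpow_neg]
    have e5 : br (1 : ℕ) = q - q⁻¹ := by simp [br]
    have e6 : bwd (1 : ℕ) = q - q⁻¹ * z := by simp [bwd]
    rw [← e1, ← e2, ← e3, ← e4, ← e5, ← e6] at key
    rw [summand_succ 0 (Nat.zero_le n), summand, antidiff]
    simp only [Nat.add_zero, Nat.mul_zero, Nat.zero_add, Nat.sub_zero, pow_zero, one_mul,
      evenBr_succ]
    rw [show g ((0 : ℕ) : ℤ) = 1 by simp [g]]
    field_simp
    linear_combination (-rhoProd 0 n 0) * key
  · rw [summand_recurrence_of_pos (Nat.zero_le n) (by omega)]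
    simp [br]

lemma telescoping_sum {ε : ℕ} (hε : ε ≤ 1) {n k : ℕ} (hk : k ≤ n) :
    ∑ i ∈ Finset.range (k + 1),
      (br ((2 * n + 1 + ε : ℕ) : ℤ) * br ((2 * n + 2 + ε : ℕ) : ℤ) * summand ε (n + 1) i -
        fwd ((2 * n + ε : ℕ) : ℤ) * summand ε n i) = antidiff ε n k := by
  induction k with
  | zero => simpa using summand_zero_recurrence hε n
  | succ k ih =>
    rw [Finset.sum_range_succ, ih (by omega), summand_recurrence_of_pos hk (by omega),
      antidiff, rhoProd_succ_right ε (by omega), show n - (k + 1) + 1 = n - k by omega,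
      show n + (k + 1) + ε = n + k + ε + 1 by omega,
      show (2 * ((k + 1 : ℕ) : ℤ) + ε - 1) = ((2 * k + 1 + ε : ℕ) : ℤ) by push_cast; ring]
    ring

lemma antidiff_self (ε n : ℕ) :
    antidiff ε n n + br ((2 * n + 1 + ε : ℕ) : ℤ) * br ((2 * n + 2 + ε : ℕ) : ℤ) *
      summand ε (n + 1) (n + 1) = 0 := by
  have h1 := evenBr_ne_zero (n + n + ε + 1)
  have h2 := br_ne_zero (show 0 < 2 * n + 2 + ε by omega)
  have h3 := br_ne_zero (show 0 < 2 * (n + n + ε + 1) + 2 by omega)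
  have hg : g ((2 * (n + 1) + ε : ℕ) : ℤ) =
      br ((2 * (n + n + ε + 1) + 2 : ℕ) : ℤ) / br ((2 * n + 2 + ε : ℕ) : ℤ) := by
    rw [g, if_neg (by omega)]
    congr 2; push_cast; ring
  have hr : rhoProd ε (n + 1) (n + 1) = bwd ((2 * n + 1 + ε : ℕ) : ℤ) * rhoProd ε n n := by
    simp [rhoProd, Finset.prod_range_succ, mul_comm]
  rw [antidiff, summand, hg, hr, show n + 1 + (n + 1) + ε = n + n + ε + 1 + 1 by omega,
    evenBr_succ (n + n + ε + 1)]
  simp only [Nat.sub_self, pow_succ]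
  have h4 := evenBr_ne_zero 0
  field_simp
  ring

lemma sum_summand_succ {ε : ℕ} (hε : ε ≤ 1) (n : ℕ) :
    br ((2 * n + 1 + ε : ℕ) : ℤ) * br ((2 * n + 2 + ε : ℕ) : ℤ) *
        ∑ k ∈ Finset.range (n + 2), summand ε (n + 1) k =
      fwd ((2 * n + ε : ℕ) : ℤ) * ∑ k ∈ Finset.range (n + 1), summand ε n k := by
  have h := telescoping_sum hε (le_refl n)
  rw [Finset.sum_sub_distrib, ← Finset.mul_sum, ← Finset.mul_sum] at h
  rw [Finset.sum_range_succ]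
  linear_combination h + antidiff_self ε n

lemma sum_summand {ε : ℕ} (hε : ε ≤ 1) (n : ℕ) :
    oddBr (n + ε) * evenBr n * ∑ k ∈ Finset.range (n + 1), summand ε n k =
      ∏ i ∈ Finset.range n, fwd ((2 * i + ε : ℕ) : ℤ) := by
  induction n with
  | zero =>
    obtain rfl | rfl : ε = 0 ∨ ε = 1 := by omega
    · simp [summand, oddBr, evenBr, rhoProd, g]
    · have h1 : br 1 ≠ 0 := mod_cast br_ne_zero one_pos
      have h2 : br 2 ≠ 0 := mod_cast br_ne_zero two_pos
      simp [summand, oddBr, evenBr, rhoProd, g]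
      field_simp
  | succ n ih =>
    have h : oddBr (n + 1 + ε) * evenBr (n + 1) = oddBr (n + ε) * evenBr n *
        (br ((2 * n + 1 + ε : ℕ) : ℤ) * br ((2 * n + 2 + ε : ℕ) : ℤ)) := by
      rw [show n + 1 + ε = n + ε + 1 by omega, oddBr_succ, evenBr_succ]
      obtain rfl | rfl : ε = 0 ∨ ε = 1 := by omega
      · simp only [Nat.add_zero]; ring
      · rw [show 2 * (n + 1) + 1 = 2 * n + 2 + 1 by omega]; ring
    rw [Finset.prod_range_succ, ← ih, h, mul_assoc, sum_summand_succ hε]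
    ring

lemma prod_Icc_succ_eq_prod_Ico {M : Type*} [CommMonoid M] (f : ℕ → M) (m n : ℕ) :
    ∏ i ∈ Finset.Icc (m + 1) n, f i = ∏ i ∈ Finset.Ico m n, f (i + 1) := by
  rw [Finset.prod_Ico_add' f m n 1]
  rfl

lemma prod_Icc_one_eq_prod_range {M : Type*} [CommMonoid M] (f : ℕ → M) (n : ℕ) :
    ∏ i ∈ Finset.Icc 1 n, f i = ∏ i ∈ Finset.range n, f (i + 1) := by
  rw [Finset.range_eq_Ico, ← prod_Icc_succ_eq_prod_Ico]

lemma rho_eq_rhoProd {ε d n : ℕ} (hε : ε ≤ 1) (h : d + 1 = 2 * n + ε) (k : ℕ) :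
    rho d (2 * k + ε) = rhoProd ε n k := by
  obtain rfl | rfl : ε = 0 ∨ ε = 1 := by omega
  · rw [rho, if_pos (by omega), show (2 * k + 0) / 2 = k by omega,
      show (d + 1) / 2 = n by omega, prod_Icc_one_eq_prod_range, prod_Icc_succ_eq_prod_Ico, rhoProd]
    congr 1 <;> refine Finset.prod_congr rfl fun i _ => ?_ <;> simp only [bwd, fwd] <;>
      push_cast <;> ring_nf
  · rw [rho, if_neg (by omega), show (2 * k + 1 - 1) / 2 = k by omega,
      show (2 * k + 1 + 1) / 2 = k + 1 by omega, show d / 2 = n by omega,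
      prod_Icc_one_eq_prod_range, prod_Icc_succ_eq_prod_Ico, rhoProd]
    congr 1

lemma cz_eq_prod_range {ε d n : ℕ} (hε : ε ≤ 1) (h : d + 1 = 2 * n + ε) :
    cz d = ∏ i ∈ Finset.range n, fwd ((2 * i + ε : ℕ) : ℤ) := by
  obtain rfl | rfl : ε = 0 ∨ ε = 1 := by omega
  · rw [cz, if_pos (by omega), show (d + 1) / 2 = n by omega, prod_Icc_one_eq_prod_range]
    refine Finset.prod_congr rfl fun i _ => ?_
    rw [fwd]; push_cast; ring_nf
  · rw [cz, if_neg (by omega), show d / 2 = n by omega, prod_Icc_one_eq_prod_range]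
    refine Finset.prod_congr rfl fun i _ => ?_
    rw [fwd]; push_cast; ring_nf

lemma a_eq {ε n k : ℕ} (hε : ε ≤ 1) (hk : k ≤ n) :
    a ((2 * k + ε : ℕ) : ℤ) (2 * n + ε) =
      oddBr (n + ε) * evenBr n * ((-1) ^ k * g ((2 * k + ε : ℕ) : ℤ) /
        (evenBr (n - k) * evenBr (n + k + ε))) := by
  have hodd : ∏ i ∈ Finset.Icc 1 (n + ε), br (2 * (i : ℤ) - 1) = oddBr (n + ε) := by
    rw [prod_Icc_one_eq_prod_range, oddBr]
    refine Finset.prod_congr rfl fun i _ => ?_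
    congr 1; push_cast; ring
  have heven (m : ℕ) : ∏ i ∈ Finset.range m, br (2 * ((i + 1 : ℕ) : ℤ)) = evenBr m :=
    Finset.prod_congr rfl fun i _ => by congr 1
  have htail : ∏ i ∈ Finset.Icc (n + 1) (n + k + ε), br (2 * (i : ℤ)) =
      evenBr (n + k + ε) / evenBr n := by
    rw [eq_div_iff (evenBr_ne_zero n), prod_Icc_succ_eq_prod_Ico, ← heven n, ← heven (n + k + ε),
      mul_comm]
    exact Finset.prod_range_mul_prod_Ico _ (by omega)
  rw [a, if_pos (by omega), Int.toNat_natCast, show (2 * k + ε) / 2 = k by omega,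
    show (2 * n + ε + 1) / 2 = n + ε by omega, show (2 * n + ε + 2) / 2 = n + 1 by omega,
    show (2 * n + ε - (2 * k + ε)) / 2 = n - k by omega,
    show (2 * n + ε + (2 * k + ε)) / 2 = n + k + ε by omega, hodd, htail,
    prod_Icc_one_eq_prod_range, heven]
  have h1 := evenBr_ne_zero n
  have h2 := evenBr_ne_zero (n - k)
  have h3 := evenBr_ne_zero (n + k + ε)
  field_simp

/-- **Normalization identity for the type-`D` `R`-matrix**:
`Σ_{j=0, j ≡ d+1 (mod 2)}^{d+1} ρ_j(z) · a_{j,d+1} = c(z)`. -/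
theorem typeD_R_matrix_normalization (d : ℕ) :
    ∑ j ∈ (Finset.range (d + 2)).filter (fun j => j % 2 = (d + 1) % 2),
      rho d j * a (j : ℤ) (d + 1) = cz d := by
  obtain ⟨ε, n, hε, h⟩ : ∃ ε n : ℕ, ε ≤ 1 ∧ d + 1 = 2 * n + ε :=
    ⟨(d + 1) % 2, (d + 1) / 2, by omega, by omega⟩
  have hsum : ∑ j ∈ (Finset.range (d + 2)).filter (fun j => j % 2 = (d + 1) % 2),
      rho d j * a (j : ℤ) (d + 1) =
      ∑ k ∈ Finset.range (n + 1), rho d (2 * k + ε) * a ((2 * k + ε : ℕ) : ℤ) (d + 1) := by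
    symm
    refine Finset.sum_bij (fun k _ => 2 * k + ε) ?_ ?_ ?_ fun _ _ => rfl
    · intro k hk
      simp only [Finset.mem_filter, Finset.mem_range] at hk ⊢
      omega
    · intro k _ k' _ hkk
      omega
    · intro j hj
      simp only [Finset.mem_filter, Finset.mem_range] at hj
      exact ⟨j / 2, Finset.mem_range.2 (by omega), by omega⟩
  rw [hsum, cz_eq_prod_range hε h, ← sum_summand hε, Finset.mul_sum]
  refine Finset.sum_congr rfl fun k hk => ?_
  rw [rho_eq_rhoProd hε h, h, a_eq hε (by rw [Finset.mem_range] at hk; omega), summand]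
  ring

end
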